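/- Suppose the weighted composition operator uC_φ is invertible on the Bloch space, φ is a hyperbolic automorphism with attractive fixed point a ∈ ∂D and repulsive fixed point b ∈ ∂D, and u is in the disc algebra. Then the spectral radius of uC_φ on the Bloch space equals max{|u(a)|, |u(b)|}, and the spectrum is contained in the annulus {λ : min{|u(a)|,|u(b)|} ≤ |λ| ≤ max{|u(a)|,|u(b)|}}. -/

import Mathlib

open Complex Metric Set Filter MeasureTheory Finset

noncomputable section

/-- The open unit disc in ℂ. -/
def D1 : Set ℂ := Metric.ball 0 1

/-- Analytic (holomorphic) on the open unit disc. -/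
def AnalyticOnD (f : ℂ → ℂ) : Prop := DifferentiableOn ℂ f D1

/-- Bloch seminorm. -/
def blochSemi (f : ℂ → ℂ) : ℝ := ⨆ z : D1, (1 - ‖(z : ℂ)‖ ^ 2) * ‖deriv f (z : ℂ)‖

/-- Bloch norm. -/
def blochNorm (f : ℂ → ℂ) : ℝ := ‖f 0‖ + blochSemi f

/-- Membership in the Bloch space. -/
def InBloch (f : ℂ → ℂ) : Prop :=
  AnalyticOnD f ∧ ∃ C, ∀ z ∈ D1, (1 - ‖z‖ ^ 2) * ‖deriv f z‖ ≤ C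

/-- Sup norm over the unit disc. -/
def supNormD (f : ℂ → ℂ) : ℝ := ⨆ z : D1, ‖f (z : ℂ)‖

/-- Weighted composition operator uC_φ. -/
def wco (u φ : ℂ → ℂ) (f : ℂ → ℂ) : ℂ → ℂ := fun z => u z * f (φ z)

/-- Multiplication operator M_u. -/
def mult (u : ℂ → ℂ) (f : ℂ → ℂ) : ℂ → ℂ := fun z => u z * f z

/-- The weight u_{(n)} = ∏_{j=0}^{n-1} u ∘ φ_j. -/
def wprod (u φ : ℂ → ℂ) (n : ℕ) : ℂ → ℂ := fun z => ∏ j ∈ Finset.range n, u (φ^[j] z)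

/-- Boundedness of an operator on the Bloch space. -/
def BddOnBloch (T : (ℂ → ℂ) → (ℂ → ℂ)) : Prop :=
  ∃ C, ∀ f, InBloch f → InBloch (T f) ∧ blochNorm (T f) ≤ C * blochNorm f

/-- Operator norm on the Bloch space. -/
def opNormB (T : (ℂ → ℂ) → (ℂ → ℂ)) : ℝ :=
  sInf {C : ℝ | 0 ≤ C ∧ ∀ f, InBloch f → blochNorm (T f) ≤ C * blochNorm f}

/-- Invertibility of an operator on the Bloch space (bounded two-sided inverse). -/
def InvertibleOnBloch (T : (ℂ → ℂ) → (ℂ → ℂ)) : Prop :=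
  BddOnBloch T ∧ ∃ S, BddOnBloch S ∧
    ∀ f, InBloch f → Set.EqOn (S (T f)) f D1 ∧ Set.EqOn (T (S f)) f D1

/-- Spectrum of an operator acting on the Bloch space. -/
def blochSpectrum (T : (ℂ → ℂ) → (ℂ → ℂ)) : Set ℂ :=
  {lam | ¬ InvertibleOnBloch (fun f z => lam * f z - T f z)}

/-- Automorphism of the unit disc (Möbius form). -/
def IsDiscAuto (φ : ℂ → ℂ) : Prop :=
  ∃ lam a : ℂ, ‖lam‖ = 1 ∧ a ∈ D1 ∧ ∀ z, φ z = lam * (a - z) / (1 - (starRingEnd ℂ) a * z)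

/-- Hyperbolic distance on the unit disc. -/
def hypDist (z w : ℂ) : ℝ :=
  (1 / 2) * Real.log ((1 + ‖(z - w) / (1 - (starRingEnd ℂ) z * w)‖) /
    (1 - ‖(z - w) / (1 - (starRingEnd ℂ) z * w)‖))

/-- The disc algebra A(𝔻). -/
def InDiscAlgebra (u : ℂ → ℂ) : Prop :=
  ContinuousOn u (Metric.closedBall 0 1) ∧ AnalyticOnD u

/-- u is bounded away from zero on the unit disc. -/
def BoundedAwayFromZero (u : ℂ → ℂ) : Prop := ∃ δ > 0, ∀ z ∈ D1, δ ≤ ‖u z‖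

/-- Parabolic automorphism with unique fixed point a on the unit circle (φ'(a)=1). -/
def IsParabolicAuto (φ : ℂ → ℂ) (a : ℂ) : Prop :=
  IsDiscAuto φ ∧ ‖a‖ = 1 ∧ φ a = a ∧ deriv φ a = 1 ∧
    ∀ w, ‖w‖ ≤ 1 → φ w = w → w = a

/-- Hyperbolic automorphism with attractive fixed point a and repulsive fixed point b. -/
def IsHyperbolicAuto (φ : ℂ → ℂ) (a b : ℂ) : Prop :=
  IsDiscAuto φ ∧ ‖a‖ = 1 ∧ ‖b‖ = 1 ∧ a ≠ b ∧ φ a = a ∧ φ b = b ∧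
    ∃ μ : ℝ, 0 < μ ∧ μ < 1 ∧ deriv φ a = (μ : ℂ)

/-- Square of the Dirichlet norm (normalized area measure on 𝔻). -/
def dirichletNormSq (f : ℂ → ℂ) : ℝ :=
  ‖f 0‖ ^ 2 + (1 / Real.pi) * ∫ z in D1, ‖deriv f z‖ ^ 2

/-- Dirichlet norm. -/
def dirichletNorm (f : ℂ → ℂ) : ℝ := Real.sqrt (dirichletNormSq f)

/-- Membership in the Dirichlet space. -/
def InDirichlet (f : ℂ → ℂ) : Prop :=
  AnalyticOnD f ∧ MeasureTheory.IntegrableOn (fun z => ‖deriv f z‖ ^ 2) D1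

/-- Boundedness of an operator on the Dirichlet space. -/
def BddOnDirichlet (T : (ℂ → ℂ) → (ℂ → ℂ)) : Prop :=
  ∃ C, ∀ f, InDirichlet f → InDirichlet (T f) ∧ dirichletNorm (T f) ≤ C * dirichletNorm f

/-- Operator norm on the Dirichlet space. -/
def opNormDir (T : (ℂ → ℂ) → (ℂ → ℂ)) : ℝ :=
  sInf {C : ℝ | 0 ≤ C ∧ ∀ f, InDirichlet f → dirichletNorm (T f) ≤ C * dirichletNorm f}

/-- Invertibility of an operator on the Dirichlet space. -/
def InvertibleOnDirichlet (T : (ℂ → ℂ) → (ℂ → ℂ)) : Prop :=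
  BddOnDirichlet T ∧ ∃ S, BddOnDirichlet S ∧
    ∀ f, InDirichlet f → Set.EqOn (S (T f)) f D1 ∧ Set.EqOn (T (S f)) f D1

/-- Spectrum of an operator on the Dirichlet space. -/
def dirichletSpectrum (T : (ℂ → ℂ) → (ℂ → ℂ)) : Set ℂ :=
  {lam | ¬ InvertibleOnDirichlet (fun f z => lam * f z - T f z)}

/-- Operator norm of M_{u'} : B → H^∞_{v₁}. -/
def opNormBtoHv1 (u : ℂ → ℂ) : ℝ :=
  sInf {C : ℝ | 0 ≤ C ∧ ∀ f, InBloch f → ∀ z ∈ D1,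
    (1 - ‖z‖ ^ 2) * ‖deriv u z * f z‖ ≤ C * blochNorm f}

/-- Operator norm of M_{u'} : 𝒟 → A². -/
def opNormDtoA2 (u : ℂ → ℂ) : ℝ :=
  sInf {C : ℝ | 0 ≤ C ∧ ∀ f, InDirichlet f →
    Real.sqrt ((1 / Real.pi) * ∫ z in D1, ‖deriv u z * f z‖ ^ 2) ≤ C * dirichletNorm f}

/-- The logarithmic weight log(e/(1-|z|²)). -/
def logWeight (z : ℂ) : ℝ := Real.log (Real.exp 1 / (1 - ‖z‖ ^ 2))

/-- Characterization of multipliers of the Bloch space: u ∈ H^∞ and the log condition. -/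
def MultBChar (u : ℂ → ℂ) : Prop :=
  (∃ M, ∀ z ∈ D1, ‖u z‖ ≤ M) ∧
  (∃ M, ∀ z ∈ D1, (1 - ‖z‖ ^ 2) * ‖deriv u z‖ * logWeight z ≤ M)

lemma mem_D1 {z : ℂ} : z ∈ D1 ↔ ‖z‖ < 1 := by simp [D1]

lemma D1_open : IsOpen D1 := Metric.isOpen_ball

lemma zero_mem_D1 : (0 : ℂ) ∈ D1 := by simp [D1]

instance D1_nonempty : Nonempty D1 := ⟨⟨0, zero_mem_D1⟩⟩

lemma wpos {z : ℂ} (hz : z ∈ D1) : 0 < 1 - ‖z‖ ^ 2 := by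
  have := mem_D1.1 hz
  nlinarith [norm_nonneg z]

lemma le_semi {f : ℂ → ℂ} (hf : InBloch f) {z : ℂ} (hz : z ∈ D1) :
    (1 - ‖z‖ ^ 2) * ‖deriv f z‖ ≤ blochSemi f := by
  obtain ⟨C, hC⟩ := hf.2
  exact le_ciSup (f := fun z : D1 => (1 - ‖(z : ℂ)‖ ^ 2) * ‖deriv f (z : ℂ)‖)
    ⟨C, by rintro _ ⟨w, rfl⟩; exact hC w w.2⟩ ⟨z, hz⟩

lemma semi_le {f : ℂ → ℂ} {C : ℝ} (h : ∀ z ∈ D1, (1 - ‖z‖ ^ 2) * ‖deriv f z‖ ≤ C) :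
    blochSemi f ≤ C := ciSup_le fun z => h z z.2

lemma semi_nonneg (f : ℂ → ℂ) : 0 ≤ blochSemi f :=
  Real.iSup_nonneg fun z => mul_nonneg (wpos z.2).le (norm_nonneg _)

lemma bnorm_nonneg (f : ℂ → ℂ) : 0 ≤ blochNorm f := add_nonneg (norm_nonneg _) (semi_nonneg f)

lemma semi_le_norm (f : ℂ → ℂ) : blochSemi f ≤ blochNorm f :=
  le_add_of_nonneg_left (norm_nonneg _)

lemma diffAt {f : ℂ → ℂ} (hf : DifferentiableOn ℂ f D1) {z : ℂ} (hz : z ∈ D1) :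
    DifferentiableAt ℂ f z := hf.differentiableAt (D1_open.mem_nhds hz)

lemma eval_le {f : ℂ → ℂ} (hf : InBloch f) {z : ℂ} (hz : z ∈ D1) :
    ‖f z‖ ≤ ‖f 0‖ + blochSemi f / (1 - ‖z‖ ^ 2) := by
  have hz1 := mem_D1.1 hz
  have key : ‖f z - f 0‖ ≤ blochSemi f / (1 - ‖z‖ ^ 2) * ‖z - 0‖ := by
    refine (convex_closedBall (0 : ℂ) ‖z‖).norm_image_sub_le_of_norm_deriv_le
      (f := f) (fun w hw => ?_) (fun w hw => ?_) (by simp) (by simp)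
    · refine diffAt hf.1 (mem_D1.2 ?_)
      simp at hw; linarith
    · simp at hw
      have hwD : w ∈ D1 := mem_D1.2 (by linarith)
      rw [le_div_iff₀ (wpos hz)]
      refine le_trans ?_ (le_semi hf hwD)
      rw [mul_comm]
      gcongr
  have h2 : blochSemi f / (1 - ‖z‖ ^ 2) * ‖z - 0‖ ≤ blochSemi f / (1 - ‖z‖ ^ 2) := by
    apply mul_le_of_le_one_right (div_nonneg (semi_nonneg f) (wpos hz).le)
    simpa using hz1.le
  have := norm_sub_norm_le (f z) (f 0)
  linarith

/-- constant for evaluation -/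
def evalC (z : ℂ) : ℝ := 1 + 1 / (1 - ‖z‖ ^ 2)

lemma evalC_pos {z : ℂ} (hz : z ∈ D1) : 0 < evalC z := by
  have := wpos hz
  unfold evalC; positivity

lemma eval_le' {f : ℂ → ℂ} (hf : InBloch f) {z : ℂ} (hz : z ∈ D1) :
    ‖f z‖ ≤ evalC z * blochNorm f := by
  have h := eval_le hf hz
  have := wpos hz
  have h1 : blochSemi f / (1 - ‖z‖ ^ 2) ≤ blochNorm f / (1 - ‖z‖ ^ 2) := by
    gcongr; exact semi_le_norm f
  have h2 : ‖f 0‖ ≤ blochNorm f := le_add_of_nonneg_right (semi_nonneg f)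
  have : evalC z * blochNorm f = blochNorm f + blochNorm f / (1 - ‖z‖ ^ 2) := by
    unfold evalC; ring
  linarith

lemma deriv_congrD {f g : ℂ → ℂ} (h : Set.EqOn f g D1) {z : ℂ} (hz : z ∈ D1) :
    deriv f z = deriv g z :=
  Filter.EventuallyEq.deriv_eq (h.eventuallyEq_of_mem (D1_open.mem_nhds hz))

lemma bloch_congr {f g : ℂ → ℂ} (h : Set.EqOn f g D1) (hf : InBloch f) : InBloch g := by
  refine ⟨hf.1.congr fun z hz => (h hz).symm, ?_⟩
  obtain ⟨C, hC⟩ := hf.2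
  exact ⟨C, fun z hz => by rw [← deriv_congrD h hz]; exact hC z hz⟩

lemma bnorm_congr {f g : ℂ → ℂ} (h : Set.EqOn f g D1) : blochNorm f = blochNorm g := by
  unfold blochNorm blochSemi
  rw [h zero_mem_D1]
  congr 1
  exact iSup_congr fun z => by rw [deriv_congrD h z.2]

lemma bloch_const (c : ℂ) : InBloch (fun _ => c) :=
  ⟨differentiableOn_const c, 0, fun z _ => by simp⟩

lemma bnorm_one : blochNorm (fun _ => (1 : ℂ)) = 1 := by simp [blochNorm, blochSemi]

lemma bloch_smul_sub {f g : ℂ → ℂ} (c d : ℂ) (hf : InBloch f) (hg : InBloch g) :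
    InBloch (fun z => c * f z - d * g z) ∧
      blochNorm (fun z => c * f z - d * g z) ≤ ‖c‖ * blochNorm f + ‖d‖ * blochNorm g := by
  have key : ∀ z ∈ D1, (1 - ‖z‖ ^ 2) * ‖deriv (fun z => c * f z - d * g z) z‖ ≤
      ‖c‖ * blochSemi f + ‖d‖ * blochSemi g := by
    intro z hz
    have h1 := diffAt hf.1 hz
    have h2 := diffAt hg.1 hz
    have : deriv (fun z => c * f z - d * g z) z = c * deriv f z - d * deriv g z :=
      ((h1.hasDerivAt.const_mul c).sub (h2.hasDerivAt.const_mul d)).deriv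
    rw [this]
    have h3 := norm_sub_le (c * deriv f z) (d * deriv g z)
    rw [norm_mul, norm_mul] at h3
    have h4 := mul_le_mul_of_nonneg_left (le_semi hf hz) (norm_nonneg c)
    have h5 := mul_le_mul_of_nonneg_left (le_semi hg hz) (norm_nonneg d)
    have h6 := mul_le_mul_of_nonneg_left h3 (wpos hz).le
    nlinarith
  refine ⟨⟨?_, _, key⟩, ?_⟩
  · exact (hf.1.const_mul c).sub (hg.1.const_mul d)
  · have h1 := semi_le key
    have h2 := norm_sub_le (c * f 0) (d * g 0)
    rw [norm_mul, norm_mul] at h2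
    unfold blochNorm
    nlinarith

/-- self maps contracting the hyperbolic metric -/
structure SM (φ : ℂ → ℂ) : Prop where
  diff : DifferentiableOn ℂ φ D1
  maps : Set.MapsTo φ D1 D1
  pick : ∀ z ∈ D1, (1 - ‖z‖ ^ 2) * ‖deriv φ z‖ ≤ 1 - ‖φ z‖ ^ 2

lemma SM.comp {φ ψ : ℂ → ℂ} (hφ : SM φ) (hψ : SM ψ) : SM (φ ∘ ψ) := by
  refine ⟨hφ.diff.comp hψ.diff hψ.maps, hφ.maps.comp hψ.maps, fun z hz => ?_⟩
  have h1 : deriv (φ ∘ ψ) z = deriv φ (ψ z) * deriv ψ z :=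
    deriv_comp z (diffAt hφ.diff (hψ.maps hz)) (diffAt hψ.diff hz)
  rw [h1, norm_mul]
  have h2 := mul_le_mul_of_nonneg_right (hψ.pick z hz) (norm_nonneg (deriv φ (ψ z)))
  have h3 := hφ.pick _ (hψ.maps hz)
  simp only [Function.comp]
  nlinarith

lemma SM.iter {φ : ℂ → ℂ} (hφ : SM φ) : ∀ n : ℕ, SM (φ^[n])
  | 0 => ⟨differentiableOn_id, fun z hz => hz, fun z _ => by simp⟩
  | n + 1 => by rw [Function.iterate_succ]; exact (hφ.iter n).comp hφ

lemma SM.semi {φ f : ℂ → ℂ} (hφ : SM φ) (hf : InBloch f) :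
    InBloch (fun z => f (φ z)) ∧ blochSemi (fun z => f (φ z)) ≤ blochSemi f := by
  have key : ∀ z ∈ D1, (1 - ‖z‖ ^ 2) * ‖deriv (fun z => f (φ z)) z‖ ≤ blochSemi f := by
    intro z hz
    have h1 : deriv (fun z => f (φ z)) z = deriv f (φ z) * deriv φ z :=
      deriv_comp z (diffAt hf.1 (hφ.maps hz)) (diffAt hφ.diff hz)
    rw [h1, norm_mul]
    have h2 := mul_le_mul_of_nonneg_right (hφ.pick z hz) (norm_nonneg (deriv f (φ z)))
    have h3 := le_semi hf (hφ.maps hz)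
    nlinarith
  exact ⟨⟨hf.1.comp hφ.diff hφ.maps, _, key⟩, semi_le key⟩

/-- growth constant -/
def grow (φ : ℂ → ℂ) : ℝ := 1 / (1 - ‖φ 0‖ ^ 2)

lemma SM.grow_pos {φ : ℂ → ℂ} (hφ : SM φ) : 0 < grow φ :=
  one_div_pos.2 (wpos (hφ.maps zero_mem_D1))

lemma SM.iter_zero {φ f : ℂ → ℂ} (hφ : SM φ) (hf : InBloch f) (n : ℕ) :
    ‖f (φ^[n] 0)‖ ≤ ‖f 0‖ + n * grow φ * blochSemi f := by
  induction n with
  | zero => simp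
  | succ n ih =>
    obtain ⟨h1, h2⟩ := (hφ.iter n).semi hf
    have h3 := eval_le h1 (hφ.maps zero_mem_D1)
    have h4 : blochSemi (fun z => f (φ^[n] z)) / (1 - ‖φ 0‖ ^ 2) ≤ grow φ * blochSemi f := by
      unfold grow
      rw [one_div_mul_eq_div]
      have := wpos (hφ.maps zero_mem_D1)
      gcongr
    rw [Function.iterate_succ_apply]
    push_cast
    nlinarith

lemma SM.iter_norm {φ f : ℂ → ℂ} (hφ : SM φ) (hf : InBloch f) (n : ℕ) :
    blochNorm (fun z => f (φ^[n] z)) ≤ (1 + n * grow φ) * blochNorm f := by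
  have h1 := hφ.iter_zero hf n
  have h2 := ((hφ.iter n).semi hf).2
  have h3 := mul_nonneg (mul_nonneg (Nat.cast_nonneg (α := ℝ) n) hφ.grow_pos.le) (norm_nonneg (f 0))
  unfold blochNorm at *
  nlinarith

lemma wprod_succ (u φ : ℂ → ℂ) (n : ℕ) (z : ℂ) :
    wprod u φ (n + 1) z = u z * wprod u φ n (φ z) := by
  simp only [wprod]
  rw [Finset.prod_range_succ', mul_comm]
  simp [Function.iterate_succ_apply]

lemma wco_iter (u φ f : ℂ → ℂ) (n : ℕ) (z : ℂ) :
    (wco u φ)^[n] f z = wprod u φ n z * f (φ^[n] z) := by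
  induction n generalizing z with
  | zero => simp [wprod]
  | succ n ih =>
    rw [Function.iterate_succ_apply', wprod_succ, Function.iterate_succ_apply]
    simp only [wco]
    rw [ih]; ring

lemma bdd_iter {T : (ℂ → ℂ) → (ℂ → ℂ)} (hT : BddOnBloch T) {f : ℂ → ℂ} (hf : InBloch f) (n : ℕ) :
    InBloch (T^[n] f) := by
  obtain ⟨C, hC⟩ := hT
  induction n with
  | zero => exact hf
  | succ n ih => rw [Function.iterate_succ_apply']; exact (hC _ ih).1

lemma bdd_const {T : (ℂ → ℂ) → (ℂ → ℂ)} (hT : BddOnBloch T) :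
    ∃ C, 0 < C ∧ ∀ f, InBloch f → InBloch (T f) ∧ blochNorm (T f) ≤ C * blochNorm f := by
  obtain ⟨C, hC⟩ := hT
  refine ⟨max C 1, by positivity, fun f hf => ⟨(hC f hf).1, (hC f hf).2.trans ?_⟩⟩
  exact mul_le_mul_of_nonneg_right (le_max_left _ _) (bnorm_nonneg f)

/-- polynomially corrected geometric growth of the powers -/
def PG (T : (ℂ → ℂ) → (ℂ → ℂ)) (Q B : ℝ) : Prop :=
  ∀ n : ℕ, ∀ f, InBloch f → InBloch (T^[n] f) ∧
    blochNorm (T^[n] f) ≤ Q * ((n : ℝ) + 1) ^ 2 * B ^ n * blochNorm f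

lemma upper {u φ : ℂ → ℂ} {ψ : ℂ → ℝ} {B C : ℝ} (hφ : SM φ) (hu : DifferentiableOn ℂ u D1)
    (hT : BddOnBloch (wco u φ)) (hψ0 : ∀ z, 0 ≤ ψ z) (hψ1 : ∀ z, ψ z ≤ 1) (hB : 0 < B)
    (hC : 0 ≤ C)
    (hub : ∀ z ∈ D1, ‖u z‖ ≤ B * Real.exp (C * (ψ z - ψ (φ z)))) :
    ∃ Q, 0 < Q ∧ PG (wco u φ) Q B := by
  obtain ⟨c, hc0, hc⟩ := bdd_const hT
  have hK := hφ.grow_pos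
  set K := grow φ with hKdef
  have hW : ∀ n, ∀ z ∈ D1, ‖wprod u φ n z‖ ≤ B ^ n * Real.exp (C * ψ z) := by
    intro n
    induction n with
    | zero =>
      intro z hz
      simpa [wprod] using mul_nonneg hC (hψ0 z)
    | succ n ih =>
      intro z hz
      rw [wprod_succ, norm_mul]
      refine (mul_le_mul (hub z hz) (ih _ (hφ.maps hz)) (norm_nonneg _) (by positivity)).trans
        (le_of_eq ?_)
      rw [show C * ψ z = C * (ψ z - ψ (φ z)) + C * ψ (φ z) by ring, Real.exp_add]; ring
  have hWd : ∀ n, DifferentiableOn ℂ (wprod u φ n) D1 := by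
    intro n
    induction n with
    | zero =>
      have : wprod u φ 0 = fun _ => 1 := by ext; simp [wprod]
      rw [this]; exact differentiableOn_const _
    | succ n ih =>
      have : wprod u φ (n + 1) = fun z => u z * wprod u φ n (φ z) := by
        ext z; exact wprod_succ u φ n z
      rw [this]; exact hu.mul (ih.comp hφ.diff hφ.maps)
  have hE : ∀ z, Real.exp (C * ψ z) ≤ Real.exp C := fun z =>
    Real.exp_le_exp.2 (mul_le_of_le_one_right hC (hψ1 z))
  have hE1 : ∀ z, 1 ≤ Real.exp (C * ψ z) := fun z =>
    Real.one_le_exp (mul_nonneg hC (hψ0 z))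
  -- the multiplier type estimate
  set L := c + B * Real.exp C with hL
  have hLpos : 0 < L := by positivity
  have hA : ∀ f, InBloch f → ∀ n : ℕ, ∀ z ∈ D1,
      (1 - ‖z‖ ^ 2) * (‖deriv u z‖ * ‖f (φ^[n + 1] z)‖) ≤ L * (1 + n * K) * blochNorm f := by
    intro f hf n z hz
    have hg := ((hφ.iter n).semi hf).1
    have hgn := hφ.iter_norm hf n
    set g : ℂ → ℂ := fun z => f (φ^[n] z) with hgdef
    obtain ⟨h1, h2⟩ := hc g hg
    obtain ⟨h3, h4⟩ := hφ.semi hg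
    have h5 := le_semi h1 hz
    have h6 := le_semi h3 hz
    have hd : deriv (wco u φ g) z = deriv u z * g (φ z) + u z * deriv (fun z => g (φ z)) z :=
      ((diffAt hu hz).hasDerivAt.mul (diffAt h3.1 hz).hasDerivAt).deriv
    have h7 : deriv u z * g (φ z) = deriv (wco u φ g) z - u z * deriv (fun z => g (φ z)) z := by
      rw [hd]; ring
    have h8 : f (φ^[n + 1] z) = g (φ z) := by rw [Function.iterate_succ_apply]
    rw [h8, ← norm_mul, h7]
    have h9 := norm_sub_le (deriv (wco u φ g) z) (u z * deriv (fun z => g (φ z)) z)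
    rw [norm_mul] at h9
    have h10 : ‖u z‖ ≤ B * Real.exp C := by
      refine (hub z hz).trans ?_
      gcongr
      refine mul_le_of_le_one_right hC ?_
      linarith [hψ1 z, hψ0 (φ z)]
    have h11 : (1 - ‖z‖ ^ 2) * (‖u z‖ * ‖deriv (fun z => g (φ z)) z‖) ≤
        B * Real.exp C * blochNorm g := by
      rw [mul_left_comm]
      exact mul_le_mul h10 (h6.trans (h4.trans (semi_le_norm g)))
        (mul_nonneg (wpos hz).le (norm_nonneg _)) (by positivity)
    have h12 := mul_le_mul_of_nonneg_left h9 (wpos hz).le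
    have h13 : blochSemi (wco u φ g) ≤ c * blochNorm g := (semi_le_norm _).trans h2
    have h14 : L * blochNorm g ≤ L * ((1 + n * K) * blochNorm f) := by gcongr
    rw [hL] at h14 ⊢
    nlinarith
  -- the derivative of the weight
  set A := L * (1 + K) * Real.exp C / B with hAdef
  have hApos : 0 < A := by positivity
  have hD : ∀ f, InBloch f → ∀ n : ℕ, ∀ z ∈ D1,
      (1 - ‖z‖ ^ 2) * (‖deriv (wprod u φ n) z‖ * ‖f (φ^[n] z)‖) ≤
        A * (n : ℝ) ^ 2 * B ^ n * Real.exp (C * ψ z) * blochNorm f := by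
    intro f hf n
    induction n with
    | zero =>
      intro z hz
      have : wprod u φ 0 = fun _ => 1 := by ext; simp [wprod]
      simp [this]
    | succ n ih =>
      intro z hz
      have hφz := hφ.maps hz
      have e1 : wprod u φ (n + 1) = fun z => u z * wprod u φ n (φ z) := by
        ext z; exact wprod_succ u φ n z
      have e2 : deriv (wprod u φ (n + 1)) z = deriv u z * wprod u φ n (φ z) +
          u z * (deriv (wprod u φ n) (φ z) * deriv φ z) := by
        rw [e1]
        exact ((diffAt hu hz).hasDerivAt.mul
          ((diffAt (hWd n) hφz).hasDerivAt.comp z (diffAt hφ.diff hz).hasDerivAt)).deriv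
      have h1 := hA f hf n z hz
      have h2 := ih (φ z) hφz
      have h3 := hφ.pick z hz
      rw [← Function.iterate_succ_apply] at h2
      set F := ‖f (φ^[n + 1] z)‖
      have hF : 0 ≤ F := norm_nonneg _
      have hw := wpos hz
      have hbn := bnorm_nonneg f
      have t1 : (1 - ‖z‖ ^ 2) * (‖deriv u z‖ * F) * ‖wprod u φ n (φ z)‖ ≤
          (L * ((n + 1) * (1 + K)) * blochNorm f) * (B ^ n * (Real.exp C * Real.exp (C * ψ z))) := by
        refine mul_le_mul (h1.trans ?_) ((hW n _ hφz).trans ?_) (norm_nonneg _) (by positivity)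
        · gcongr
          have : (0 : ℝ) ≤ n := Nat.cast_nonneg n
          nlinarith
        · gcongr
          nlinarith [hE (φ z), hE1 z, Real.exp_pos C]
      have t2 : ‖u z‖ * ((1 - ‖φ z‖ ^ 2) * (‖deriv (wprod u φ n) (φ z)‖ * F)) ≤
          B * Real.exp (C * (ψ z - ψ (φ z))) *
            (A * (n : ℝ) ^ 2 * B ^ n * Real.exp (C * ψ (φ z)) * blochNorm f) := by
        refine mul_le_mul (hub z hz) h2 ?_ (by positivity)
        have := wpos hφz
        positivity
      have t2' : B * Real.exp (C * (ψ z - ψ (φ z))) *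
            (A * (n : ℝ) ^ 2 * B ^ n * Real.exp (C * ψ (φ z)) * blochNorm f) =
            A * (n : ℝ) ^ 2 * B ^ (n + 1) * Real.exp (C * ψ z) * blochNorm f := by
        rw [show C * ψ z = C * (ψ z - ψ (φ z)) + C * ψ (φ z) by ring, Real.exp_add]; ring
      have t1' : (L * ((n + 1) * (1 + K)) * blochNorm f) *
          (B ^ n * (Real.exp C * Real.exp (C * ψ z))) =
          A * ((n : ℝ) + 1) * B ^ (n + 1) * Real.exp (C * ψ z) * blochNorm f := by
        rw [hAdef]; field_simp; ring
      have t3 : (1 - ‖z‖ ^ 2) * (‖deriv (wprod u φ (n + 1)) z‖ * F) ≤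
          (1 - ‖z‖ ^ 2) * (‖deriv u z‖ * F) * ‖wprod u φ n (φ z)‖ +
          ‖u z‖ * ((1 - ‖φ z‖ ^ 2) * (‖deriv (wprod u φ n) (φ z)‖ * F)) := by
        rw [e2]
        have := norm_add_le (deriv u z * wprod u φ n (φ z))
          (u z * (deriv (wprod u φ n) (φ z) * deriv φ z))
        simp only [norm_mul] at this
        have s1 := mul_le_mul_of_nonneg_left (mul_le_mul_of_nonneg_right this hF) hw.le
        have s2 := mul_le_mul_of_nonneg_right h3
          (mul_nonneg (norm_nonneg (u z)) (mul_nonneg (norm_nonneg (deriv (wprod u φ n) (φ z))) hF))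
        linarith
      rw [t1'] at t1
      rw [t2'] at t2
      have t4 : 0 ≤ A * (n : ℝ) * B ^ (n + 1) * Real.exp (C * ψ z) * blochNorm f := by positivity
      push_cast
      nlinarith
  refine ⟨Real.exp C * (1 + K + A + 1), by positivity, fun n f hf => ⟨bdd_iter hT hf n, ?_⟩⟩
  have hbn := bnorm_nonneg f
  have hn : (0 : ℝ) ≤ n := Nat.cast_nonneg n
  have e : (wco u φ)^[n] f = fun z => wprod u φ n z * f (φ^[n] z) := by
    ext z; exact wco_iter u φ f n z
  have hsemi : blochSemi ((wco u φ)^[n] f) ≤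
      (A * (n : ℝ) ^ 2 + 1) * (B ^ n * Real.exp C * blochNorm f) := by
    refine semi_le fun z hz => ?_
    obtain ⟨g1, g2⟩ := (hφ.iter n).semi hf
    have hd : deriv ((wco u φ)^[n] f) z = deriv (wprod u φ n) z * f (φ^[n] z) +
        wprod u φ n z * deriv (fun z => f (φ^[n] z)) z := by
      rw [e]
      exact ((diffAt (hWd n) hz).hasDerivAt.mul (diffAt g1.1 hz).hasDerivAt).deriv
    rw [hd]
    have h1 := norm_add_le (deriv (wprod u φ n) z * f (φ^[n] z))
      (wprod u φ n z * deriv (fun z => f (φ^[n] z)) z)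
    simp only [norm_mul] at h1
    have h2 := hD f hf n z hz
    have h3 := le_semi g1 hz
    have h4 : ‖wprod u φ n z‖ * ((1 - ‖z‖ ^ 2) * ‖deriv (fun z => f (φ^[n] z)) z‖) ≤
        (B ^ n * Real.exp C) * blochNorm f := by
      refine mul_le_mul ((hW n z hz).trans ?_) (h3.trans (g2.trans (semi_le_norm f)))
        (mul_nonneg (wpos hz).le (norm_nonneg _)) (by positivity)
      gcongr
      exact mul_le_of_le_one_right hC (hψ1 z)
    have h5 : A * (n : ℝ) ^ 2 * B ^ n * Real.exp (C * ψ z) * blochNorm f ≤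
        A * (n : ℝ) ^ 2 * B ^ n * Real.exp C * blochNorm f := by
      gcongr
      exact mul_le_of_le_one_right hC (hψ1 z)
    have h6 := mul_le_mul_of_nonneg_left h1 (wpos hz).le
    linarith
  have h0 : ‖(wco u φ)^[n] f 0‖ ≤ (1 + n * K) * (B ^ n * Real.exp C * blochNorm f) := by
    rw [wco_iter, norm_mul]
    have h1 := hφ.iter_zero hf n
    have h2 : ‖f (φ^[n] 0)‖ ≤ (1 + n * K) * blochNorm f := by
      have h3 := mul_nonneg (mul_nonneg hn hK.le) (norm_nonneg (f 0))
      have h4 := semi_nonneg f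
      unfold blochNorm
      nlinarith
    have h3 : ‖wprod u φ n 0‖ ≤ B ^ n * Real.exp C := by
      refine (hW n 0 zero_mem_D1).trans ?_
      gcongr
      exact mul_le_of_le_one_right hC (hψ1 0)
    calc _ ≤ (B ^ n * Real.exp C) * ((1 + n * K) * blochNorm f) :=
          mul_le_mul h3 h2 (norm_nonneg _) (by positivity)
      _ = _ := by ring
  have hfin : (1 + n * K) + (A * (n : ℝ) ^ 2 + 1) ≤ (1 + K + A + 1) * ((n : ℝ) + 1) ^ 2 := by
    nlinarith [mul_nonneg hn hK.le, mul_nonneg hn hApos.le, mul_nonneg (mul_nonneg hn hn) hK.le,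
      mul_nonneg hn hn]
  have hX : 0 ≤ B ^ n * Real.exp C * blochNorm f := by positivity
  have := mul_le_mul_of_nonneg_right hfin hX
  unfold blochNorm at *
  linarith

lemma summ_aux {r : ℝ} (h0 : 0 ≤ r) (h1 : r < 1) : Summable fun k : ℕ => ((k : ℝ) + 1) ^ 2 * r ^ k := by
  have hr : ‖r‖ < 1 := by rwa [Real.norm_of_nonneg h0]
  have e0 := summable_pow_mul_geometric_of_norm_lt_one 0 hr
  have e1 := summable_pow_mul_geometric_of_norm_lt_one 1 hr
  have e2 := summable_pow_mul_geometric_of_norm_lt_one 2 hr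
  refine ((e2.add (e1.mul_left 2)).add e0).congr fun k => ?_
  ring

lemma neumann {v θ : ℂ → ℂ} (hθ : Set.MapsTo θ D1 D1) {Q B : ℝ} (hQ : 0 < Q) (hB : 0 < B)
    (hP : PG (wco v θ) Q B) {c : ℂ} (hc : ‖c‖ * B < 1) :
    ∃ G : (ℂ → ℂ) → (ℂ → ℂ), BddOnBloch G ∧
      (∀ f g, Set.EqOn f g D1 → Set.EqOn (G f) (G g) D1) ∧
      (∀ f, InBloch f → ∀ z ∈ D1, G f z - c * wco v θ (G f) z = f z) ∧
      (∀ f, InBloch f → ∀ z ∈ D1, G (fun w => f w - c * wco v θ f w) z = f z) := by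
  set s : ℕ → ℝ := fun k => Q * (((k : ℝ) + 1) ^ 2 * (‖c‖ * B) ^ k) with hs
  have hs0 : ∀ k, 0 ≤ s k := fun k => by positivity
  have hsum : Summable s := (summ_aux (by positivity) hc).mul_left Q
  have hpt : ∀ f, InBloch f → ∀ z ∈ D1, ∀ k : ℕ,
      ‖c ^ k * (wco v θ)^[k] f z‖ ≤ s k * (evalC z * blochNorm f) := by
    intro f hf z hz k
    obtain ⟨h1, h2⟩ := hP k f hf
    have h3 := eval_le' h1 hz
    have := evalC_pos hz
    rw [norm_mul, norm_pow]
    calc ‖c‖ ^ k * ‖(wco v θ)^[k] f z‖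
        ≤ ‖c‖ ^ k * (evalC z * (Q * ((k : ℝ) + 1) ^ 2 * B ^ k * blochNorm f)) := by
          gcongr; exact h3.trans (by gcongr)
      _ = _ := by simp only [hs, mul_pow]; ring
  have hsm : ∀ f, InBloch f → ∀ z ∈ D1, Summable fun k : ℕ => c ^ k * (wco v θ)^[k] f z := by
    intro f hf z hz
    exact Summable.of_norm_bounded (hsum.mul_right _) (hpt f hf z hz)
  refine ⟨fun f z => ∑' k : ℕ, c ^ k * (wco v θ)^[k] f z, ?_, ?_, ?_, ?_⟩
  · refine ⟨(∑' k, s k) * evalC 0 + ∑' k, s k, fun f hf => ?_⟩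
    have hd : ∀ z ∈ D1, ∀ k : ℕ, (1 - ‖z‖ ^ 2) * ‖c ^ k * deriv ((wco v θ)^[k] f) z‖ ≤
        s k * blochNorm f := by
      intro z hz k
      obtain ⟨h1, h2⟩ := hP k f hf
      have h3 := (le_semi h1 hz).trans ((semi_le_norm _).trans h2)
      rw [norm_mul, norm_pow, mul_left_comm]
      calc _ ≤ ‖c‖ ^ k * (Q * ((k : ℝ) + 1) ^ 2 * B ^ k * blochNorm f) := by gcongr
        _ = _ := by simp only [hs, mul_pow]; ring
    have hder : ∀ z ∈ D1, HasDerivAt (fun z => ∑' k : ℕ, c ^ k * (wco v θ)^[k] f z)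
        (∑' k : ℕ, c ^ k * deriv ((wco v θ)^[k] f) z) z := by
      intro z hz
      have hz1 := mem_D1.1 hz
      set r := (1 + ‖z‖) / 2 with hr
      have hr0 : 0 ≤ r := by positivity
      have hr1 : r < 1 := by rw [hr]; linarith
      have hrz : ‖z‖ < r := by rw [hr]; linarith
      have hsub : ∀ y ∈ Metric.ball (0 : ℂ) r, y ∈ D1 := fun y hy => by
        simp at hy; exact mem_D1.2 (hy.trans hr1)
      have hrr : 0 < 1 - r ^ 2 := by nlinarith
      have hzr : z ∈ Metric.ball (0 : ℂ) r := by simpa using hrz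
      have hsu : Summable fun k => s k * blochNorm f / (1 - r ^ 2) :=
        (hsum.mul_right _).div_const _
      have hpc : IsPreconnected (Metric.ball (0 : ℂ) r) := (convex_ball _ _).isPreconnected
      refine hasDerivAt_tsum_of_isPreconnected (g := fun k y => c ^ k * (wco v θ)^[k] f y)
        (g' := fun k y => c ^ k * deriv ((wco v θ)^[k] f) y) (y := z) hsu Metric.isOpen_ball
        hpc ?_ ?_ hzr (hsm f hf z hz) hzr
      · intro k y hy
        exact (diffAt (hP k f hf).1.1 (hsub y hy)).hasDerivAt.const_mul _
      · intro k y hy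
        rw [le_div_iff₀ hrr]
        refine le_trans ?_ (hd y (hsub y hy) k)
        rw [mul_comm]
        have : ‖y‖ < r := by simpa using hy
        gcongr
    have hbd : ∀ z ∈ D1, (1 - ‖z‖ ^ 2) *
        ‖deriv (fun z => ∑' k : ℕ, c ^ k * (wco v θ)^[k] f z) z‖ ≤ (∑' k, s k) * blochNorm f := by
      intro z hz
      rw [(hder z hz).deriv, mul_comm, ← le_div_iff₀ (wpos hz), ← tsum_mul_right, ← tsum_div_const]
      refine tsum_of_norm_bounded ((hsum.mul_right _).div_const _).hasSum fun k => ?_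
      rw [le_div_iff₀ (wpos hz), mul_comm]
      exact hd z hz k
    refine ⟨⟨fun z hz => (hder z hz).differentiableAt.differentiableWithinAt, _, hbd⟩, ?_⟩
    have h0 : ‖∑' k : ℕ, c ^ k * (wco v θ)^[k] f 0‖ ≤ (∑' k, s k) * (evalC 0 * blochNorm f) := by
      rw [← tsum_mul_right]
      exact tsum_of_norm_bounded (hsum.mul_right _).hasSum (hpt f hf 0 zero_mem_D1)
    have h1 := semi_le hbd
    rw [show ∀ g : ℂ → ℂ, blochNorm g = ‖g 0‖ + blochSemi g from fun g => rfl]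
    linarith
  · intro f g h z hz
    refine tsum_congr fun k => ?_
    rw [wco_iter, wco_iter, h (hθ.iterate k hz)]
  · intro f hf z hz
    simp only [wco]
    rw [(hsm f hf z hz).tsum_eq_zero_add, ← tsum_mul_left, ← tsum_mul_left]
    have : ∀ k : ℕ, c ^ (k + 1) * (wco v θ)^[k + 1] f z =
        c * (v z * (c ^ k * (wco v θ)^[k] f (θ z))) := by
      intro k
      rw [Function.iterate_succ_apply']
      simp only [wco]; ring
    rw [tsum_congr this]
    simp
  · intro f hf z hz
    have h1 : ∀ k : ℕ, c ^ k * (wco v θ)^[k] (fun w => f w - c * wco v θ f w) z =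
        c ^ k * (wco v θ)^[k] f z - c ^ (k + 1) * (wco v θ)^[k + 1] f z := by
      intro k
      rw [Function.iterate_succ_apply, wco_iter, wco_iter, wco_iter]; ring
    beta_reduce
    rw [tsum_congr h1]
    have hs1 := hsm f hf z hz
    have hs2 := (summable_nat_add_iff 1).2 hs1
    rw [hs1.tsum_sub hs2, hs1.tsum_eq_zero_add]
    simp

lemma opNorm_le {T : (ℂ → ℂ) → (ℂ → ℂ)} {C : ℝ} (hC : 0 ≤ C)
    (h : ∀ f, InBloch f → blochNorm (T f) ≤ C * blochNorm f) : opNormB T ≤ C :=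
  csInf_le ⟨0, fun _ h => h.1⟩ ⟨hC, h⟩

lemma le_opNorm_one {T : (ℂ → ℂ) → (ℂ → ℂ)} {C : ℝ} (hC : 0 ≤ C)
    (h : ∀ f, InBloch f → blochNorm (T f) ≤ C * blochNorm f) :
    blochNorm (T fun _ => 1) ≤ opNormB T := by
  refine le_csInf ⟨C, hC, h⟩ fun D hD => ?_
  have := hD.2 _ (bloch_const 1)
  rwa [bnorm_one, mul_one] at this

lemma den_ne {p z : ℂ} (hp : p ∈ D1) (hz : ‖z‖ ≤ 1) : 1 - (starRingEnd ℂ) p * z ≠ 0 := by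
  intro h
  have h1 : (starRingEnd ℂ) p * z = 1 := (sub_eq_zero.1 h).symm
  have h2 : ‖p‖ * ‖z‖ = 1 := by
    have := congrArg norm h1
    simpa using this
  have := mem_D1.1 hp
  nlinarith [norm_nonneg z, norm_nonneg p]

lemma pick_id (p z : ℂ) : ‖1 - (starRingEnd ℂ) p * z‖ ^ 2 - ‖p - z‖ ^ 2 =
    (1 - ‖p‖ ^ 2) * (1 - ‖z‖ ^ 2) := by
  simp only [Complex.sq_norm, Complex.normSq_apply]
  simp
  ring

lemma conj_mul_self (p : ℂ) : (starRingEnd ℂ) p * p = ((‖p‖ ^ 2 : ℝ) : ℂ) := by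
  rw [mul_comm, Complex.mul_conj, Complex.normSq_eq_norm_sq]

lemma auto_deriv {φ : ℂ → ℂ} {lam p : ℂ} (hp : p ∈ D1)
    (h : ∀ z, φ z = lam * (p - z) / (1 - (starRingEnd ℂ) p * z)) {z : ℂ} (hz : ‖z‖ ≤ 1) :
    HasDerivAt φ (lam * (((‖p‖ ^ 2 - 1 : ℝ)) : ℂ) / (1 - (starRingEnd ℂ) p * z) ^ 2) z := by
  have hφ : φ = fun z => lam * (p - z) / (1 - (starRingEnd ℂ) p * z) := funext h
  rw [hφ]
  have h1 : HasDerivAt (fun z : ℂ => lam * (p - z)) (lam * (-1)) z :=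
    ((hasDerivAt_id z).const_sub p).const_mul lam
  have h2 : HasDerivAt (fun z : ℂ => 1 - (starRingEnd ℂ) p * z) (-((starRingEnd ℂ) p * 1)) z :=
    ((hasDerivAt_id z).const_mul _).const_sub 1
  refine (h1.div h2 (den_ne hp hz)).congr_deriv ?_
  congr 1
  have := conj_mul_self p
  push_cast at this ⊢
  linear_combination lam * this

lemma auto_SM {φ : ℂ → ℂ} (h : IsDiscAuto φ) : SM φ := by
  obtain ⟨lam, p, hl, hp, h⟩ := h
  have key : ∀ z ∈ D1, 1 - ‖φ z‖ ^ 2 =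
      (1 - ‖p‖ ^ 2) * (1 - ‖z‖ ^ 2) / ‖1 - (starRingEnd ℂ) p * z‖ ^ 2 := by
    intro z hz
    have h1 : 0 < ‖1 - (starRingEnd ℂ) p * z‖ := norm_pos_iff.2 (den_ne hp (mem_D1.1 hz).le)
    rw [← pick_id, h z, norm_div, norm_mul, hl]
    generalize ‖1 - (starRingEnd ℂ) p * z‖ = d at *
    field_simp
  refine ⟨fun z hz => (auto_deriv hp h (mem_D1.1 hz).le).differentiableAt.differentiableWithinAt,
    fun z hz => ?_, fun z hz => ?_⟩
  · have h1 : 0 < ‖1 - (starRingEnd ℂ) p * z‖ := norm_pos_iff.2 (den_ne hp (mem_D1.1 hz).le)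
    have h2 := key z hz
    have h3 : 0 < 1 - ‖φ z‖ ^ 2 := by
      rw [h2]
      have := wpos hp
      have := wpos hz
      positivity
    rw [mem_D1]
    nlinarith [norm_nonneg (φ z)]
  · rw [key z hz, (auto_deriv hp h (mem_D1.1 hz).le).deriv, norm_div, norm_mul, hl, norm_pow,
      Complex.norm_real, Real.norm_eq_abs, abs_sub_comm, abs_of_pos (wpos hp)]
    apply le_of_eq; ring

lemma auto_inv {φ : ℂ → ℂ} (h : IsDiscAuto φ) :
    ∃ χ, IsDiscAuto χ ∧ ∀ z, ‖z‖ ≤ 1 → χ (φ z) = z ∧ φ (χ z) = z := by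
  obtain ⟨lam, p, hl, hp, h⟩ := h
  have hll : (starRingEnd ℂ) lam * lam = 1 := by rw [conj_mul_self, hl]; simp
  have hlp : lam * p ∈ D1 := by rw [mem_D1, norm_mul, hl, one_mul]; exact mem_D1.1 hp
  have hp' : (1 : ℂ) - (starRingEnd ℂ) p * p ≠ 0 := den_ne hp (mem_D1.1 hp).le
  refine ⟨fun z => (starRingEnd ℂ) lam * (lam * p - z) / (1 - (starRingEnd ℂ) (lam * p) * z),
    ⟨(starRingEnd ℂ) lam, lam * p, by simpa using hl, hlp, fun z => rfl⟩, fun z hz => ?_⟩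
  have h1 := den_ne hp hz
  have h2 := den_ne hlp hz
  simp only [h, map_mul] at h2 ⊢
  generalize (starRingEnd ℂ) lam = L at *
  generalize (starRingEnd ℂ) p = P at *
  generalize hD : 1 - P * p = D at *
  generalize hd : 1 - P * z = d at *
  generalize hd' : 1 - L * P * z = d' at *
  constructor
  · have e1 : (1 : ℂ) - L * P * (lam * (p - z) / d) = D / d := by
      field_simp
      rw [← hd, ← hD]
      linear_combination (-P * (p - z)) * hll
    rw [e1]
    field_simp
    rw [← hd, ← hD]
    linear_combination (p * (1 - P * z) - (p - z)) * hll
  · have e1 : (1 : ℂ) - P * (L * (lam * p - z) / d') = D / d' := by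
      field_simp
      rw [← hd', ← hD]
      linear_combination (-P * p) * hll
    rw [e1]
    field_simp
    rw [← hd', ← hD]
    linear_combination (-lam * p + z - z * P * p) * hll

lemma auto_sub {φ : ℂ → ℂ} {lam p : ℂ} (hp : p ∈ D1)
    (h : ∀ z, φ z = lam * (p - z) / (1 - (starRingEnd ℂ) p * z)) {z w : ℂ} (hz : ‖z‖ ≤ 1)
    (hw : ‖w‖ ≤ 1) (hl : ‖lam‖ = 1) : ‖φ z - φ w‖ * (‖1 - (starRingEnd ℂ) p * z‖ *
      ‖1 - (starRingEnd ℂ) p * w‖) = (1 - ‖p‖ ^ 2) * ‖z - w‖ := by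
  have h1 := den_ne hp hz
  have h2 := den_ne hp hw
  have : (φ z - φ w) * ((1 - (starRingEnd ℂ) p * z) * (1 - (starRingEnd ℂ) p * w)) =
      lam * (-(((1 - ‖p‖ ^ 2 : ℝ)) : ℂ)) * (z - w) := by
    have e := conj_mul_self p
    rw [h, h]
    push_cast at e ⊢
    generalize hd1 : 1 - (starRingEnd ℂ) p * z = d1 at *
    generalize hd2 : 1 - (starRingEnd ℂ) p * w = d2 at *
    field_simp
    rw [← hd1, ← hd2]
    linear_combination (lam * (z - w)) * e
  have := congrArg norm this
  simp only [norm_mul, norm_neg, Complex.norm_real, Real.norm_eq_abs, abs_of_pos (wpos hp), hl,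
    one_mul] at this
  exact this

lemma hyp_ratio {φ : ℂ → ℂ} {a b : ℂ} (h : IsHyperbolicAuto φ a b) :
    ∃ μ : ℝ, 0 < μ ∧ μ < 1 ∧ ∀ z, ‖z‖ ≤ 1 → ‖φ z - a‖ * ‖z - b‖ = μ * ‖z - a‖ * ‖φ z - b‖ := by
  obtain ⟨⟨lam, p, hl, hp, h⟩, ha, hb, hab, hfa, hfb, μ, hμ0, hμ1, hd⟩ := h
  refine ⟨μ, hμ0, hμ1, fun z hz => ?_⟩
  have ea := auto_sub hp h hz ha.le hl
  have eb := auto_sub hp h hz hb.le hl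
  have eab := auto_sub hp h ha.le hb.le hl
  rw [hfa] at ea eab
  rw [hfb] at eb eab
  rw [(auto_deriv hp h ha.le).deriv] at hd
  have hd' := congrArg norm hd
  rw [norm_div, norm_mul, hl, norm_pow, Complex.norm_real, Complex.norm_real, Real.norm_eq_abs,
    Real.norm_eq_abs, abs_sub_comm, abs_of_pos (wpos hp), abs_of_pos hμ0, one_mul] at hd'
  have pa : 0 < ‖1 - (starRingEnd ℂ) p * a‖ := norm_pos_iff.2 (den_ne hp ha.le)
  have pb : 0 < ‖1 - (starRingEnd ℂ) p * b‖ := norm_pos_iff.2 (den_ne hp hb.le)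
  have pz : 0 < ‖1 - (starRingEnd ℂ) p * z‖ := norm_pos_iff.2 (den_ne hp hz)
  have pab : 0 < ‖a - b‖ := norm_pos_iff.2 (sub_ne_zero.2 hab)
  have pp := wpos hp
  generalize ‖1 - (starRingEnd ℂ) p * a‖ = A at *
  generalize ‖1 - (starRingEnd ℂ) p * b‖ = B at *
  generalize ‖1 - (starRingEnd ℂ) p * z‖ = Z at *
  generalize 1 - ‖p‖ ^ 2 = P at *
  have hAB : A * B = P := mul_left_cancel₀ pab.ne' (by linarith)
  have hBA : B = μ * A := by
    rw [← hd', ← hAB]; field_simp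
  have e1 : ‖φ z - a‖ = P * ‖z - a‖ / (Z * A) := by
    rw [eq_div_iff (by positivity)]; exact ea
  have e2 : ‖φ z - b‖ = P * ‖z - b‖ / (Z * B) := by
    rw [eq_div_iff (by positivity)]; exact eb
  rw [e1, e2, hBA]
  field_simp

lemma root_prod {x : ℕ → ℝ} {l : ℝ} (hx : ∀ k, 0 < x k) (hl : 0 < l)
    (h : Filter.Tendsto x Filter.atTop (nhds l)) :
    Filter.Tendsto (fun n : ℕ => (∏ k ∈ Finset.range n, x k) ^ ((1 : ℝ) / n)) Filter.atTop
      (nhds l) := by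
  have h1 := (h.log hl.ne').cesaro
  have h2 := (Real.continuous_exp.tendsto _).comp h1
  rw [Real.exp_log hl] at h2
  refine h2.congr fun n => ?_
  rw [Real.rpow_def_of_pos (Finset.prod_pos fun k _ => hx k),
    Real.log_prod (fun k _ => (hx k).ne')]
  simp only [Function.comp]
  congr 1
  rw [one_div, mul_comm]

lemma poly_root {Q : ℝ} (hQ : 0 < Q) :
    Filter.Tendsto (fun n : ℕ => (Q * ((n : ℝ) + 1) ^ 2) ^ ((1 : ℝ) / n)) Filter.atTop
      (nhds 1) := by
  have h1 : Filter.Tendsto (fun n : ℕ => Q ^ ((1 : ℝ) / n)) Filter.atTop (nhds 1) := by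
    have := (tendsto_const_nhds (x := Q)).rpow (tendsto_one_div_atTop_nhds_zero_nat (𝕜 := ℝ))
      (Or.inl hQ.ne')
    simpa using this
  have h2 : Filter.Tendsto (fun n : ℕ => ((n : ℝ) + 1) ^ ((2 : ℝ) / n)) Filter.atTop
      (nhds 1) := by
    have h3 := tendsto_rpow_div_mul_add 2 1 (-1) (by norm_num)
    have h4 : Filter.Tendsto (fun n : ℕ => (n : ℝ) + 1) Filter.atTop Filter.atTop :=
      Filter.tendsto_atTop_add_const_right _ _ tendsto_natCast_atTop_atTop
    refine (h3.comp h4).congr fun n => ?_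
    simp
  have h5 := h1.mul h2
  rw [one_mul] at h5
  refine h5.congr fun n => ?_
  have hn : (0 : ℝ) ≤ (n : ℝ) + 1 := by positivity
  rw [Real.mul_rpow hQ.le (by positivity), ← Real.rpow_natCast ((n : ℝ) + 1) 2,
    ← Real.rpow_mul hn]
  congr 2
  push_cast; ring

lemma lower_root {x ρ : ℕ → ℝ} {l Q : ℝ} (hx : ∀ k, 0 < x k) (hl : 0 < l) (hQ : 0 < Q)
    (h : Filter.Tendsto x Filter.atTop (nhds l)) (hρ : ∀ n, 0 ≤ ρ n)
    (hb : ∀ n : ℕ, ∏ k ∈ Finset.range n, x k ≤ Q * ((n : ℝ) + 1) ^ 2 * ρ n) {c : ℝ} (hc : c < l) :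
    ∀ᶠ n : ℕ in Filter.atTop, c < ρ n ^ ((1 : ℝ) / n) := by
  have h1 := (root_prod hx hl h).div (poly_root hQ) one_ne_zero
  rw [div_one] at h1
  filter_upwards [h1.eventually (lt_mem_nhds hc)] with n hn
  refine lt_of_lt_of_le hn ?_
  simp only [Pi.div_apply]
  have hp : 0 < Q * ((n : ℝ) + 1) ^ 2 := by positivity
  rw [div_le_iff₀ (Real.rpow_pos_of_pos hp _), ← Real.mul_rpow (hρ n) hp.le]
  refine Real.rpow_le_rpow (Finset.prod_nonneg fun k _ => (hx k).le) ?_ (by positivity)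
  linarith [hb n]

lemma upper_root {ρ : ℕ → ℝ} {B Q c : ℝ} (hB : 0 < B) (hQ : 0 < Q) (hρ : ∀ n, 0 ≤ ρ n)
    (hb : ∀ n : ℕ, ρ n ≤ Q * ((n : ℝ) + 1) ^ 2 * B ^ n) (hc : B < c) :
    ∀ᶠ n : ℕ in Filter.atTop, ρ n ^ ((1 : ℝ) / n) < c := by
  have h1 := (poly_root hQ).mul_const B
  rw [one_mul] at h1
  filter_upwards [h1.eventually (gt_mem_nhds hc), Filter.eventually_gt_atTop 0] with n hn hn0
  refine lt_of_le_of_lt ?_ hn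
  have hp : 0 < Q * ((n : ℝ) + 1) ^ 2 := by positivity
  refine (Real.rpow_le_rpow (hρ n) (hb n) (by positivity)).trans (le_of_eq ?_)
  rw [Real.mul_rpow hp.le (by positivity), one_div, Real.pow_rpow_inv_natCast hB.le hn0.ne']

lemma sub_pos_of_circle {z a : ℂ} (hz : z ∈ D1) (ha : ‖a‖ = 1) : 0 < ‖z - a‖ := by
  rw [norm_pos_iff, sub_ne_zero]
  rintro rfl
  exact absurd (mem_D1.1 hz) (by rw [ha]; exact lt_irrefl 1)

lemma sub_le_two {z a : ℂ} (hz : z ∈ D1) (ha : ‖a‖ = 1) : ‖z - a‖ ≤ 2 := by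
  have := norm_sub_le z a
  have := mem_D1.1 hz
  linarith

lemma conv_iter {φ : ℂ → ℂ} {a b : ℂ} {μ : ℝ} (hφ : SM φ) (ha : ‖a‖ = 1) (hb : ‖b‖ = 1)
    (h0 : 0 < μ) (h1 : μ < 1)
    (hr : ∀ z ∈ D1, ‖φ z - a‖ * ‖z - b‖ = μ * ‖z - a‖ * ‖φ z - b‖) :
    Filter.Tendsto (fun n : ℕ => φ^[n] 0) Filter.atTop (nhds a) := by
  have key : ∀ n : ℕ, ‖φ^[n] 0 - a‖ = μ ^ n * ‖φ^[n] 0 - b‖ := by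
    intro n
    induction n with
    | zero => simp [ha, hb]
    | succ n ih =>
      have hD := (hφ.iter n).maps zero_mem_D1
      have e := hr _ hD
      rw [ih] at e
      have hp := sub_pos_of_circle hD hb
      rw [Function.iterate_succ_apply']
      refine mul_right_cancel₀ hp.ne' ?_
      rw [e]; ring
  rw [tendsto_iff_norm_sub_tendsto_zero]
  refine squeeze_zero (fun n => norm_nonneg _) (g := fun n => μ ^ n * 2) (fun n => ?_) ?_
  · rw [key n]
    have := sub_le_two ((hφ.iter n).maps zero_mem_D1) hb
    gcongr
  · simpa using (tendsto_pow_atTop_nhds_zero_of_lt_one h0.le h1).mul_const 2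

/-- the bounded Lyapunov function -/
def lyap (a b z : ℂ) : ℝ := ‖z - a‖ / (‖z - a‖ + ‖z - b‖)

lemma lyap_nonneg (a b z : ℂ) : 0 ≤ lyap a b z := by unfold lyap; positivity

lemma lyap_le_one (a b z : ℂ) : lyap a b z ≤ 1 :=
  div_le_one_of_le₀ (le_add_of_nonneg_right (norm_nonneg _)) (by positivity)

lemma lyap_drop {φ : ℂ → ℂ} {a b : ℂ} {μ : ℝ} (hφ : SM φ) (ha : ‖a‖ = 1) (hb : ‖b‖ = 1)
    (h0 : 0 < μ) (h1 : μ < 1)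
    (hr : ∀ z ∈ D1, ‖φ z - a‖ * ‖z - b‖ = μ * ‖z - a‖ * ‖φ z - b‖) {z : ℂ} (hz : z ∈ D1) :
    (1 - μ) * (‖z - a‖ * ‖z - b‖) / 16 ≤ lyap a b z - lyap a b (φ z) := by
  have e := hr z hz
  have hz' := hφ.maps hz
  have p1 := sub_pos_of_circle hz ha
  have p2 := sub_pos_of_circle hz hb
  have p3 := sub_pos_of_circle hz' ha
  have p4 := sub_pos_of_circle hz' hb
  have q1 := sub_le_two hz ha
  have q2 := sub_le_two hz hb
  unfold lyap
  generalize ‖z - a‖ = X at *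
  generalize ‖z - b‖ = Y at *
  generalize ‖φ z - a‖ = X' at *
  generalize ‖φ z - b‖ = Y' at *
  have eX : X' = μ * X * Y' / Y := by rw [eq_div_iff p2.ne']; exact e
  have hd : X / (X + Y) - X' / (X' + Y') = (1 - μ) * (X * Y) / ((X + Y) * (μ * X + Y)) := by
    have : X' / (X' + Y') = μ * X / (μ * X + Y) := by
      rw [div_eq_div_iff (by positivity) (by positivity)]
      linear_combination e
    rw [this, div_sub_div _ _ (by positivity) (by positivity)]
    congr 1; ring
  rw [hd]
  have hm : 0 < 1 - μ := by linarith
  apply div_le_div_of_nonneg_left (by positivity) (by positivity)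
  have : μ * X ≤ X := by nlinarith
  nlinarith

lemma cobound {φ : ℂ → ℂ} {a b : ℂ} {μ : ℝ} (hφ : SM φ) (ha : ‖a‖ = 1) (hb : ‖b‖ = 1)
    (h0 : 0 < μ) (h1 : μ < 1)
    (hr : ∀ z ∈ D1, ‖φ z - a‖ * ‖z - b‖ = μ * ‖z - a‖ * ‖φ z - b‖)
    {h : ℂ → ℝ} {H B : ℝ} (hH : ∀ z ∈ D1, h z ≤ H) (hca : ContinuousWithinAt h D1 a)
    (hcb : ContinuousWithinAt h D1 b) (hB : 0 < B) (hBa : h a < B) (hBb : h b < B) :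
    ∃ C, 0 ≤ C ∧ ∀ z ∈ D1, h z ≤ B * Real.exp (C * (lyap a b z - lyap a b (φ z))) := by
  have ea := hca.eventually (gt_mem_nhds hBa)
  have eb := hcb.eventually (gt_mem_nhds hBb)
  obtain ⟨d1, hd1, k1⟩ := Metric.mem_nhdsWithin_iff.1 ea
  obtain ⟨d2, hd2, k2⟩ := Metric.mem_nhdsWithin_iff.1 eb
  have hm : 0 < 1 - μ := by linarith
  have hBH : B ≤ max H B := le_max_right _ _
  have hlog : 0 ≤ Real.log (max H B / B) := Real.log_nonneg (by rwa [one_le_div hB])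
  set η := (1 - μ) * (d1 * d2) / 16 with hη
  have hη0 : 0 < η := by positivity
  refine ⟨Real.log (max H B / B) / η, by positivity, fun z hz => ?_⟩
  have hdrop := lyap_drop hφ ha hb h0 h1 hr hz
  have hnn : 0 ≤ lyap a b z - lyap a b (φ z) := le_trans (by positivity) hdrop
  by_cases hn : ‖z - a‖ < d1 ∨ ‖z - b‖ < d2
  · have hzB : h z < B := by
      rcases hn with hn | hn
      · exact k1 ⟨by simpa [dist_eq_norm] using hn, hz⟩
      · exact k2 ⟨by simpa [dist_eq_norm] using hn, hz⟩
    refine hzB.le.trans (le_mul_of_one_le_right hB.le (Real.one_le_exp ?_))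
    positivity
  · push Not at hn
    have e1 : η ≤ lyap a b z - lyap a b (φ z) := by
      refine le_trans ?_ hdrop
      rw [hη]
      gcongr
      · exact hn.1
      · exact hn.2
    have e2 : Real.log (max H B / B) ≤
        Real.log (max H B / B) / η * (lyap a b z - lyap a b (φ z)) := by
      rw [div_mul_eq_mul_div, le_div_iff₀ hη0]
      gcongr
    have e3 := Real.exp_le_exp.2 e2
    rw [Real.exp_log (by positivity), div_le_iff₀ hB] at e3
    have := hH z hz
    have := le_max_left H B
    linarith

lemma le_of_pow_bound {x c E : ℝ} (hc : 0 < c) (h : ∀ n : ℕ, x ^ n ≤ E * c ^ n) : x ≤ c := by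
  by_contra hlt
  push Not at hlt
  have h1 : 1 < x / c := by rwa [one_lt_div hc]
  obtain ⟨n, hn⟩ := pow_unbounded_of_one_lt E h1
  have := h n
  rw [div_pow, lt_div_iff₀ (by positivity)] at hn
  linarith

lemma inv_bound {u φ χ : ℂ → ℂ} (hφ : SM φ) (hinv : ∀ z ∈ D1, χ (φ z) = z)
    (hR : BddOnBloch (wco (fun z => (u (χ z))⁻¹) χ)) :
    ∃ c, 0 < c ∧ ∀ z ∈ D1, ‖u z‖⁻¹ ≤ c := by
  obtain ⟨c, hc0, hc⟩ := bdd_const hR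
  have hg := hφ.grow_pos
  set c' := (1 + grow φ) * c with hc'
  have hc'0 : 0 < c' := by positivity
  have key : ∀ n : ℕ, InBloch (fun z => ((u z)⁻¹) ^ n) ∧
      blochNorm (fun z => ((u z)⁻¹) ^ n) ≤ c' ^ n := by
    intro n
    induction n with
    | zero => simpa [bnorm_one] using bloch_const 1
    | succ n ih =>
      obtain ⟨i1, i2⟩ := ih
      obtain ⟨j1, j2⟩ := hc _ i1
      have k1 := (hφ.semi j1).1
      have k2 := hφ.iter_norm j1 1
      simp only [Function.iterate_one, Nat.cast_one, one_mul] at k2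
      have heq : Set.EqOn (fun z => wco (fun z => (u (χ z))⁻¹) χ (fun z => ((u z)⁻¹) ^ n) (φ z))
          (fun z => ((u z)⁻¹) ^ (n + 1)) D1 := by
        intro z hz
        simp only [wco, hinv z hz]; ring
      refine ⟨bloch_congr heq k1, ?_⟩
      rw [← bnorm_congr heq]
      calc _ ≤ _ := k2
        _ ≤ (1 + grow φ) * (c * c' ^ n) := by
          gcongr
          exact j2.trans (by gcongr)
        _ = c' ^ (n + 1) := by rw [hc']; ring
  refine ⟨c', hc'0, fun z hz => le_of_pow_bound (E := evalC z) hc'0 fun n => ?_⟩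
  have h1 := eval_le' (key n).1 hz
  rw [norm_pow, norm_inv] at h1
  refine h1.trans ?_
  have := evalC_pos hz
  gcongr
  exact (key n).2

lemma wprod_back {u φ χ : ℂ → ℂ} (hχ : SM χ) (h : ∀ z ∈ D1, φ (χ z) = z) (n : ℕ) :
    wprod u φ n (χ^[n] 0) = ∏ k ∈ Finset.range n, u (χ^[k + 1] 0) := by
  induction n with
  | zero => simp [wprod]
  | succ n ih =>
    rw [wprod_succ, Finset.prod_range_succ, ← ih]
    rw [Function.iterate_succ_apply', h _ ((hχ.iter n).maps zero_mem_D1), mul_comm]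

/-- hyperbolic case on B: spectral radius and annulus containment. -/
theorem stmt_16 (u φ : ℂ → ℂ) (a b : ℂ) (hu : InDiscAlgebra u)
    (hh : IsHyperbolicAuto φ a b) (hinv : InvertibleOnBloch (wco u φ)) :
    Filter.Tendsto (fun n : ℕ => opNormB ((wco u φ)^[n]) ^ ((1 : ℝ) / n))
        Filter.atTop (nhds (max ‖u a‖ ‖u b‖)) ∧
      blochSpectrum (wco u φ) ⊆
        {lam : ℂ | min ‖u a‖ ‖u b‖ ≤ ‖lam‖ ∧ ‖lam‖ ≤ max ‖u a‖ ‖u b‖} := by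
  obtain ⟨huc, hud⟩ := hu
  obtain ⟨μ, hμ0, hμ1, hrat⟩ := hyp_ratio hh
  obtain ⟨hauto, ha, hb, hab, -⟩ := hh
  obtain ⟨χ, hχa, hχ⟩ := auto_inv hauto
  have hφ := auto_SM hauto
  have hχs := auto_SM hχa
  have hχφ : ∀ z ∈ D1, χ (φ z) = z := fun z hz => (hχ z (mem_D1.1 hz).le).1
  have hφχ : ∀ z ∈ D1, φ (χ z) = z := fun z hz => (hχ z (mem_D1.1 hz).le).2
  have hr : ∀ z ∈ D1, ‖φ z - a‖ * ‖z - b‖ = μ * ‖z - a‖ * ‖φ z - b‖ :=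
    fun z hz => hrat z (mem_D1.1 hz).le
  have hr' : ∀ z ∈ D1, ‖χ z - b‖ * ‖z - a‖ = μ * ‖z - b‖ * ‖χ z - a‖ := by
    intro z hz
    have := hr _ (hχs.maps hz)
    rw [hφχ z hz] at this
    linarith
  obtain ⟨hT, S, hS, hST⟩ := hinv
  have hu0 : ∀ z ∈ D1, u z ≠ 0 := by
    intro z hz h0
    have := (hST _ (bloch_const 1)).2 hz
    simp [wco, h0] at this
  set v : ℂ → ℂ := fun z => (u (χ z))⁻¹ with hv
  have hRS : ∀ f, InBloch f → Set.EqOn (S f) (wco v χ f) D1 := by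
    intro f hf w hw
    have h1 := (hST f hf).2 (hχs.maps hw)
    simp only [wco, hφχ w hw] at h1
    have h2 := hu0 _ (hχs.maps hw)
    simp only [wco, hv]
    rw [← h1, inv_mul_cancel_left₀ h2]
  have hR : BddOnBloch (wco v χ) := by
    obtain ⟨C, hC⟩ := hS
    refine ⟨C, fun f hf => ⟨bloch_congr (hRS f hf) (hC f hf).1, ?_⟩⟩
    rw [← bnorm_congr (hRS f hf)]
    exact (hC f hf).2
  obtain ⟨c, hc0, hc⟩ := inv_bound hφ hχφ hR
  have hlow : ∀ z ∈ D1, c⁻¹ ≤ ‖u z‖ := fun z hz =>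
    inv_le_of_inv_le₀ (norm_pos_iff.2 (hu0 z hz)) (hc z hz)
  have hDsub : D1 ⊆ Metric.closedBall 0 1 := Metric.ball_subset_closedBall
  have hua : ContinuousWithinAt u D1 a := (huc a (by simp [ha])).mono hDsub
  have hub : ContinuousWithinAt u D1 b := (huc b (by simp [hb])).mono hDsub
  have hza := conv_iter hφ ha hb hμ0 hμ1 hr
  have hzb := conv_iter hχs hb ha hμ0 hμ1 hr'
  have hta : Filter.Tendsto (fun n : ℕ => ‖u (φ^[n] 0)‖) Filter.atTop (nhds ‖u a‖) :=
    (hua.tendsto.comp (tendsto_nhdsWithin_iff.2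
      ⟨hza, Filter.Eventually.of_forall fun n => (hφ.iter n).maps zero_mem_D1⟩)).norm
  have htb0 : Filter.Tendsto (fun n : ℕ => ‖u (χ^[n] 0)‖) Filter.atTop (nhds ‖u b‖) :=
    (hub.tendsto.comp (tendsto_nhdsWithin_iff.2
      ⟨hzb, Filter.Eventually.of_forall fun n => (hχs.iter n).maps zero_mem_D1⟩)).norm
  have htb : Filter.Tendsto (fun n : ℕ => ‖u (χ^[n + 1] 0)‖) Filter.atTop (nhds ‖u b‖) :=
    htb0.comp (Filter.tendsto_add_atTop_nat 1)
  have hua0 : 0 < ‖u a‖ := lt_of_lt_of_le (inv_pos.2 hc0)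
    (ge_of_tendsto' hta fun n => hlow _ ((hφ.iter n).maps zero_mem_D1))
  have hub0 : 0 < ‖u b‖ := lt_of_lt_of_le (inv_pos.2 hc0)
    (ge_of_tendsto' htb fun n => hlow _ ((hχs.iter (n + 1)).maps zero_mem_D1))
  obtain ⟨U, hU⟩ := (isCompact_closedBall (0 : ℂ) 1).exists_bound_of_continuousOn huc
  -- upper growth for the operator
  have hup : ∀ B, max ‖u a‖ ‖u b‖ < B → ∃ Q, 0 < Q ∧ PG (wco u φ) Q B := by
    intro B hB
    have hB1 := (le_max_left _ _).trans_lt hB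
    have hB2 := (le_max_right _ _).trans_lt hB
    obtain ⟨C, hC0, hC⟩ := cobound hφ ha hb hμ0 hμ1 hr (h := fun z => ‖u z‖) (H := U)
      (fun z hz => hU z (hDsub hz)) hua.norm hub.norm (hua0.trans hB1) hB1 hB2
    exact upper hφ hud hT (lyap_nonneg a b) (lyap_le_one a b) (hua0.trans hB1) hC0 hC
  -- upper growth for the inverse
  have hdn : ∀ B, 0 < B → B < min ‖u a‖ ‖u b‖ → ∃ Q, 0 < Q ∧ PG (wco v χ) Q B⁻¹ := by
    intro B hB0 hB
    have hB1 := hB.trans_le (min_le_left _ _)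
    have hB2 := hB.trans_le (min_le_right _ _)
    obtain ⟨C, hC0, hC⟩ := cobound hφ ha hb hμ0 hμ1 hr (h := fun z => ‖u z‖⁻¹) (H := c)
      hc (hua.norm.inv₀ hua0.ne') (hub.norm.inv₀ hub0.ne') (inv_pos.2 hB0)
      (inv_strictAnti₀ hB0 hB1) (inv_strictAnti₀ hB0 hB2)
    refine upper (ψ := fun z => 1 - lyap a b z) (C := C) hχs
      ((hud.comp hχs.diff hχs.maps).inv fun z hz => hu0 _ (hχs.maps hz)) hR
      (fun z => by linarith [lyap_le_one a b z]) (fun z => by linarith [lyap_nonneg a b z])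
      (inv_pos.2 hB0) hC0 fun z hz => ?_
    have h1 := hC _ (hχs.maps hz)
    rw [hφχ z hz] at h1
    simp only [hv, norm_inv]
    convert h1 using 4
    ring
  have hM0 : 0 < max ‖u a‖ ‖u b‖ := lt_max_of_lt_left hua0
  constructor
  · obtain ⟨Q, hQ, hPG⟩ := hup (max ‖u a‖ ‖u b‖ + 1) (by linarith)
    have hρ0 : ∀ n : ℕ, 0 ≤ opNormB ((wco u φ)^[n]) := fun n =>
      Real.sInf_nonneg fun _ h => h.1
    have hone : ∀ n : ℕ, blochNorm ((wco u φ)^[n] fun _ => 1) ≤ opNormB ((wco u φ)^[n]) := by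
      intro n
      exact le_opNorm_one (C := Q * ((n : ℝ) + 1) ^ 2 * (max ‖u a‖ ‖u b‖ + 1) ^ n)
        (by positivity) fun f hf => (hPG n f hf).2
    refine tendsto_order.2 ⟨fun x hx => ?_, fun x hx => ?_⟩
    · rcases lt_max_iff.1 hx with hx | hx
      · refine lower_root (fun k => norm_pos_iff.2 (hu0 _ ((hφ.iter k).maps zero_mem_D1)))
          hua0 one_pos hta hρ0 (fun n => ?_) hx
        have h1 := hone n
        have h2 : ‖(wco u φ)^[n] (fun _ => 1) 0‖ ≤ opNormB ((wco u φ)^[n]) :=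
          (le_add_of_nonneg_right (semi_nonneg _)).trans h1
        rw [wco_iter, mul_one, wprod, norm_prod] at h2
        refine h2.trans (le_mul_of_one_le_left (hρ0 n) ?_)
        have : (0 : ℝ) ≤ n := Nat.cast_nonneg n
        nlinarith
      · have hg := hχs.grow_pos
        refine lower_root (Q := 1 + grow χ)
          (fun k => norm_pos_iff.2 (hu0 _ ((hχs.iter (k + 1)).maps zero_mem_D1)))
          hub0 (by positivity) htb hρ0 (fun n => ?_) hx
        have hB := (hPG n _ (bloch_const 1)).1
        have h1 := hχs.iter_norm hB n
        have h2 : ‖(wco u φ)^[n] (fun _ => 1) (χ^[n] 0)‖ ≤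
            (1 + n * grow χ) * opNormB ((wco u φ)^[n]) :=
          ((le_add_of_nonneg_right (semi_nonneg _)).trans h1).trans
            (mul_le_mul_of_nonneg_left (hone n) (by positivity))
        rw [wco_iter, mul_one, wprod_back hχs hφχ, norm_prod] at h2
        refine h2.trans (mul_le_mul_of_nonneg_right ?_ (hρ0 n))
        have : (0 : ℝ) ≤ n := Nat.cast_nonneg n
        nlinarith [mul_nonneg this hg.le, mul_nonneg (mul_nonneg this this) hg.le]
    · obtain ⟨B, hB1, hB2⟩ := exists_between hx
      obtain ⟨Q', hQ', hPG'⟩ := hup B hB1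
      have hB0 := hM0.trans hB1
      exact upper_root hB0 hQ' hρ0 (fun n => opNorm_le (by positivity)
        fun f hf => (hPG' n f hf).2) hB2
  · intro lam hlam
    have hbdd : BddOnBloch (fun f z => lam * f z - wco u φ f z) := by
      obtain ⟨C, hC0, hC⟩ := bdd_const hT
      refine ⟨‖lam‖ + C, fun f hf => ?_⟩
      obtain ⟨h1, h2⟩ := bloch_smul_sub lam 1 hf (hC f hf).1
      simp only [one_mul, norm_one] at h1 h2
      refine ⟨h1, h2.trans ?_⟩
      have := (hC f hf).2
      linarith
    by_contra hnot
    apply hlam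
    rw [Set.mem_ofPred_eq, not_and_or, not_le, not_le] at hnot
    rcases hnot with hlt | hgt
    · obtain ⟨B, hB1, hB2⟩ := exists_between hlt
      have hB0 : 0 < B := (norm_nonneg _).trans_lt hB1
      obtain ⟨Q, hQ, hPG⟩ := hdn B hB0 hB2
      obtain ⟨G, hG1, hG2, hG3, hG4⟩ := neumann hχs.maps hQ (inv_pos.2 hB0) hPG (c := lam)
        (by rw [← div_eq_mul_inv, div_lt_one hB0]; exact hB1)
      refine ⟨hbdd, fun f z => -(G (wco v χ f) z), ?_, fun f hf => ⟨fun z hz => ?_, fun z hz => ?_⟩⟩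
      · obtain ⟨C1, hC10, hC1⟩ := bdd_const hG1
        obtain ⟨C2, hC20, hC2⟩ := bdd_const hR
        refine ⟨C1 * C2, fun f hf => ?_⟩
        obtain ⟨i1, i2⟩ := hC2 f hf
        obtain ⟨j1, j2⟩ := hC1 _ i1
        obtain ⟨k1, k2⟩ := bloch_smul_sub (-1) 0 j1 j1
        simp only [neg_one_mul, zero_mul, sub_zero, norm_neg, norm_one, norm_zero, one_mul,
          add_zero] at k1 k2
        refine ⟨k1, k2.trans (j2.trans ?_)⟩
        rw [mul_assoc]
        gcongr
      · have heq : Set.EqOn (wco v χ (fun z => lam * f z - wco u φ f z))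
            (fun w => -1 * (f w - lam * wco v χ f w)) D1 := by
          intro w hw
          have := hu0 _ (hχs.maps hw)
          simp only [wco, hv, hφχ w hw]
          field_simp
          ring
        -- the operator is odd, so apply it to the negative
        have hfn : InBloch (fun w => -f w) := by
          have := (bloch_smul_sub (-1) 0 hf hf).1
          simpa using this
        have heq' : Set.EqOn (wco v χ (fun z => lam * f z - wco u φ f z))
            (fun w => (fun w => -f w) w - lam * wco v χ (fun w => -f w) w) D1 := by
          intro w hw
          rw [heq hw]
          simp only [wco]; ring
        show -(G (wco v χ (fun z => lam * f z - wco u φ f z)) z) = f z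
        rw [hG2 _ _ heq' hz, hG4 _ hfn z hz, neg_neg]
      · obtain ⟨C2, hC2⟩ := hR
        have h1 := hG3 _ (hC2 f hf).1 _ (hφ.maps hz)
        have h0 := hu0 z hz
        change lam * -(G (wco v χ f) z) - u z * -(G (wco v χ f) (φ z)) = f z
        generalize G (wco v χ f) = g at h1 ⊢
        simp only [wco, hv, hχφ z hz] at h1
        field_simp at h1
        linear_combination h1
    · obtain ⟨B, hB1, hB2⟩ := exists_between hgt
      have hB0 : 0 < B := hM0.trans hB1
      have hl0 : lam ≠ 0 := norm_pos_iff.1 (hB0.trans hB2)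
      obtain ⟨Q, hQ, hPG⟩ := hup B hB1
      obtain ⟨G, hG1, hG2, hG3, hG4⟩ := neumann hφ.maps hQ hB0 hPG (c := lam⁻¹)
        (by rw [norm_inv, inv_mul_eq_div, div_lt_one (hB0.trans hB2)]; exact hB2)
      have hsc : ∀ f, InBloch f → InBloch (fun z => lam⁻¹ * f z) ∧
          blochNorm (fun z => lam⁻¹ * f z) ≤ ‖lam⁻¹‖ * blochNorm f := by
        intro f hf
        have := bloch_smul_sub lam⁻¹ 0 hf hf
        simpa using this
      refine ⟨hbdd, fun f => G (fun z => lam⁻¹ * f z), ?_,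
        fun f hf => ⟨fun z hz => ?_, fun z hz => ?_⟩⟩
      · obtain ⟨C1, hC10, hC1⟩ := bdd_const hG1
        refine ⟨C1 * ‖lam⁻¹‖, fun f hf => ?_⟩
        obtain ⟨i1, i2⟩ := hsc f hf
        obtain ⟨j1, j2⟩ := hC1 _ i1
        refine ⟨j1, j2.trans ?_⟩
        rw [mul_assoc]
        gcongr
      · rw [← hG4 f hf z hz]
        refine hG2 _ _ (fun w _ => ?_) hz
        simp only [wco]
        field_simp
      · have h1 := hG3 _ (hsc f hf).1 z hz
        simp only [wco] at h1 ⊢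
        have h2 := congrArg (fun x => lam * x) h1
        simp only [mul_sub, mul_inv_cancel_left₀ hl0] at h2
        exact h2
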